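/- One has lim_{μ → ∞} m_{1,μ} = 2π·m̂_{1/√(2π)}; moreover m_{1,μ} ≤ 2π·m̂_{1/√(2π)} for every μ > 0. -/

import Mathlib

noncomputable section

open MeasureTheory Real Filter

namespace Waveguide

/-- A point of the waveguide `ℝ³ × 𝕋`, modelled as `ℝ³ × ℝ` with functions that are
`2π`-periodic in the second coordinate. -/
abbrev Pt : Type := (Fin 3 → ℝ) × ℝ

/-- The fundamental domain `ℝ³ × (0, 2π]` of the waveguide `ℝ³ × 𝕋`. -/
def Dom : Set Pt := Set.univ ×ˢ Set.Ioc 0 (2 * π)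

/-- `2π`-periodicity in the `y` variable. -/
def PeriodicY (u : Pt → ℝ) : Prop := ∀ x y, u (x, y + 2 * π) = u (x, y)

/-- The `i`-th horizontal coordinate direction. -/
def ex (i : Fin 3) : Pt := (fun j => if j = i then 1 else 0, 0)

/-- The vertical (periodic) direction. -/
def ey : Pt := (0, 1)

/-- `i`-th partial derivative in the `x` variables. -/
def gradx (u : Pt → ℝ) (p : Pt) (i : Fin 3) : ℝ := fderiv ℝ u p (ex i)

/-- Partial derivative in the `y` variable, `u_y`. -/
def grady (u : Pt → ℝ) (p : Pt) : ℝ := fderiv ℝ u p ey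

/-- `|∇_x u|²`. -/
def gradSqX (u : Pt → ℝ) (p : Pt) : ℝ := ∑ i, (gradx u p i) ^ 2

/-- `|∇_{x,y} u|²`. -/
def gradSq (u : Pt → ℝ) (p : Pt) : ℝ := gradSqX u p + (grady u p) ^ 2

/-- Membership in (a regular repesentative of) `H¹(ℝ³ × 𝕋)`, for real valued functions. -/
structure H1 (u : Pt → ℝ) : Prop where
  periodic : PeriodicY u
  diff : Differentiable ℝ u
  memL2 : IntegrableOn (fun p => (u p) ^ 2) Dom
  memGrad : IntegrableOn (fun p => gradSq u p) Dom
  memL4 : IntegrableOn (fun p => (u p) ^ 4) Dom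

/-- The `L²(ℝ³ × 𝕋)` norm. -/
def l2 (u : Pt → ℝ) : ℝ := Real.sqrt (∫ p in Dom, (u p) ^ 2)

/-- `u ∈ S_Θ`. -/
def inS (Θ : ℝ) (u : Pt → ℝ) : Prop := H1 u ∧ l2 u = Θ

/-- The nonlinear density `u⁴ + 2u²v² + v⁴`. -/
def nonlin (u v : Pt → ℝ) (p : Pt) : ℝ :=
  (u p) ^ 4 + 2 * (u p) ^ 2 * (v p) ^ 2 + (v p) ^ 4

/-- The energy functional `I(u,v)`. -/
def energy (u v : Pt → ℝ) : ℝ :=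
  (1 / 2) * (∫ p in Dom, (gradSq u p + gradSq v p))
    - (1 / 4) * ∫ p in Dom, nonlin u v p

/-- The semivirial functional `Q(u,v)`. -/
def svirial (u v : Pt → ℝ) : ℝ :=
  (∫ p in Dom, (gradSqX u p + gradSqX v p))
    - (3 / 4) * ∫ p in Dom, nonlin u v p

/-- The ground-state level `m_Θ`. -/
def mlevel (Θ : ℝ) : ℝ :=
  sInf {c | ∃ u v : Pt → ℝ, inS Θ u ∧ inS Θ v ∧ svirial u v = 0 ∧ energy u v = c}

/-- `(u,v)` is a minimizer of `m_Θ`: it lies in `V_Θ` and attains the infimum. -/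
def isMinimizer (Θ : ℝ) (u v : Pt → ℝ) : Prop :=
  inS Θ u ∧ inS Θ v ∧ svirial u v = 0 ∧ energy u v = mlevel Θ

/-- Smooth, compactly supported (in `x`) test function on the waveguide. -/
def TestFun (φ : Pt → ℝ) : Prop :=
  ContDiff ℝ (⊤ : ℕ∞) φ ∧ PeriodicY φ ∧
    ∃ K : Set (Fin 3 → ℝ), IsCompact K ∧ ∀ p : Pt, p.1 ∉ K → φ p = 0

/-- `u` is a weak solution of `-Δ_{x,y} u + lam u = f` on `ℝ³ × 𝕋`. -/
def WeakSol (lam : ℝ) (u f : Pt → ℝ) : Prop :=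
  ∀ φ : Pt → ℝ, TestFun φ →
    (∫ p in Dom,
        ((∑ i, gradx u p i * gradx φ p i) + grady u p * grady φ p + lam * u p * φ p))
      = ∫ p in Dom, f p * φ p

/-- The mass-preserving rescaling `u^τ(x,y) = τ^{3/2} u(τx, y)`. -/
def scaleX (τ : ℝ) (u : Pt → ℝ) : Pt → ℝ :=
  fun p => τ ^ ((3 : ℝ) / 2) * u (τ • p.1, p.2)

/-- `u` is independent of the `y` variable, i.e. `u_y = 0` (a.e.). -/
def Yindep (u : Pt → ℝ) : Prop := ∀ᵐ p : Pt ∂volume, grady u p = 0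

/-- The functional `J_μ(u,v)`. -/
def Jfun (μ : ℝ) (u v : Pt → ℝ) : ℝ :=
  (1 / 2) * (∫ p in Dom,
      (gradSqX u p + μ * (grady u p) ^ 2 + gradSqX v p + μ * (grady v p) ^ 2))
    - (1 / 4) * ∫ p in Dom, nonlin u v p

/-- The level `m_{1,μ}`. -/
def m1 (μ : ℝ) : ℝ :=
  sInf {c | ∃ u v : Pt → ℝ, inS 1 u ∧ inS 1 v ∧ svirial u v = 0 ∧ Jfun μ u v = c}

/-- `(u,v)` is a minimizer of `m_{1,μ}`. -/
def isMinimizerJ (μ : ℝ) (u v : Pt → ℝ) : Prop :=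
  inS 1 u ∧ inS 1 v ∧ svirial u v = 0 ∧ Jfun μ u v = m1 μ

/-! ### Objects on `ℝ³` -/

abbrev Pt3 : Type := Fin 3 → ℝ

def e3 (i : Fin 3) : Pt3 := fun j => if j = i then 1 else 0

def grad3 (w : Pt3 → ℝ) (x : Pt3) (i : Fin 3) : ℝ := fderiv ℝ w x (e3 i)

def gradSq3 (w : Pt3 → ℝ) (x : Pt3) : ℝ := ∑ i, (grad3 w x i) ^ 2

/-- Membership in (a regular representative of) `H¹(ℝ³)`. -/
structure H1R3 (w : Pt3 → ℝ) : Prop where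
  diff : Differentiable ℝ w
  memL2 : Integrable (fun x => (w x) ^ 2)
  memGrad : Integrable (fun x => gradSq3 w x)
  memL4 : Integrable (fun x => (w x) ^ 4)

/-- The `L²(ℝ³)` norm. -/
def l2R3 (w : Pt3 → ℝ) : ℝ := Real.sqrt (∫ x, (w x) ^ 2)

def nonlin3 (u v : Pt3 → ℝ) (x : Pt3) : ℝ :=
  (u x) ^ 4 + 2 * (u x) ^ 2 * (v x) ^ 2 + (v x) ^ 4

/-- The limit energy `Î(u,v)` on `ℝ³`. -/
def Ihat (u v : Pt3 → ℝ) : ℝ :=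
  (1 / 2) * (∫ x, (gradSq3 u x + gradSq3 v x)) - (1 / 4) * ∫ x, nonlin3 u v x

/-- The virial `Q̂(u,v)` on `ℝ³`. -/
def Qhat (u v : Pt3 → ℝ) : ℝ :=
  (∫ x, (gradSq3 u x + gradSq3 v x)) - (3 / 4) * ∫ x, nonlin3 u v x

/-- The ground-state energy `m̂_ρ` on `ℝ³`. -/
def mhat (ρ : ℝ) : ℝ :=
  sInf {c | ∃ u v : Pt3 → ℝ, H1R3 u ∧ H1R3 v ∧ l2R3 u = ρ ∧ l2R3 v = ρ ∧
    Qhat u v = 0 ∧ Ihat u v = c}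

lemma enorm_sub_le_lintegral_deriv {g : ℝ → ℝ} (hg : Differentiable ℝ g) (s t : ℝ) :
    ‖g t - g s‖ₑ ≤ ∫⁻ r in Set.uIoc s t, ‖deriv g r‖ₑ := by
  by_cases h : ∫⁻ r in Set.uIoc s t, ‖deriv g r‖ₑ = ⊤
  · simp [h]
  have hi : IntervalIntegrable (deriv g) volume s t :=
    intervalIntegrable_iff.2 ⟨(measurable_deriv g).aestronglyMeasurable, lt_top_iff_ne_top.2 h⟩
  rw [← intervalIntegral.integral_eq_sub_of_hasDerivAt (fun x _ => (hg x).hasDerivAt) hi,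
    ← ofReal_norm, intervalIntegral.norm_intervalIntegral_eq, ofReal_norm]
  exact enorm_integral_le_lintegral_enorm _

/-- A differentiable function on the line that comes arbitrarily close to `0` is bounded by its
total variation. -/
lemma enorm_le_lintegral_deriv {g : ℝ → ℝ} (hg : Differentiable ℝ g)
    (h0 : ∀ c : ℝ, 0 < c → ∃ t, |g t| < c) (s : ℝ) :
    ‖g s‖ₑ ≤ ∫⁻ r, ‖deriv g r‖ₑ := by
  refine ENNReal.le_of_forall_pos_le_add fun ε hε _ => ?_
  obtain ⟨t, ht⟩ := h0 ε hε
  have h1 := (enorm_sub_le_lintegral_deriv hg t s).trans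
    (setLIntegral_le_lintegral (μ := volume) (Set.uIoc t s) _)
  calc ‖g s‖ₑ = ‖(g s - g t) + g t‖ₑ := by rw [sub_add_cancel]
    _ ≤ ‖g s - g t‖ₑ + ‖g t‖ₑ := enorm_add_le _ _
    _ ≤ _ := by
      gcongr
      rw [← ofReal_norm]
      exact ENNReal.ofReal_le_of_le_toReal (by simpa using ht.le)

lemma exists_abs_lt_of_lintegral_ne_top {w : ℝ → ℝ} {k : ℕ}
    (h : ∫⁻ r, ‖w r‖ₑ ^ k ≠ ⊤) {c : ℝ} (hc : 0 < c) : ∃ t, |w t| < c := by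
  by_contra! hcon
  refine h (top_le_iff.1 ?_)
  calc (⊤ : ENNReal) = ∫⁻ _ : ℝ, (ENNReal.ofReal c) ^ k := by
        rw [lintegral_const, Real.volume_univ, ENNReal.mul_top]
        exact pow_ne_zero _ (by simpa using hc)
    _ ≤ _ := by
      refine lintegral_mono fun r => ?_
      gcongr
      rw [← ofReal_norm]
      exact ENNReal.ofReal_le_ofReal (hcon r)

lemma enorm_pow_three_deriv {w : ℝ → ℝ} (hw : Differentiable ℝ w) (r : ℝ) :
    ‖deriv (fun t => w t ^ 3) r‖ₑ = 3 * (‖w r‖ₑ ^ 2 * ‖deriv w r‖ₑ) := by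
  have h : deriv (fun t => w t ^ 3) r = 3 * (w r ^ 2 * deriv w r) := by
    have h1 : deriv (fun t => w t ^ 3) r = _ := ((hw r).hasDerivAt.pow 3).deriv
    rw [h1]; norm_num; ring
  rw [h, enorm_mul, enorm_mul, enorm_pow]
  congr 1
  rw [← ofReal_norm]; norm_num

lemma enorm_pow_three_le {w : ℝ → ℝ} (hw : Differentiable ℝ w) {k : ℕ}
    (h : ∫⁻ r, ‖w r‖ₑ ^ k ≠ ⊤) (s : ℝ) :
    ‖w s‖ₑ ^ 3 ≤ 3 * ∫⁻ r, ‖w r‖ₑ ^ 2 * ‖deriv w r‖ₑ := by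
  rw [← enorm_pow, ← lintegral_const_mul' _ _ (by norm_num)]
  simp_rw [← enorm_pow_three_deriv hw]
  refine enorm_le_lintegral_deriv (g := fun t => w t ^ 3) (hw.pow 3) (fun c hc => ?_) s
  obtain ⟨t, ht⟩ := exists_abs_lt_of_lintegral_ne_top h (lt_min hc one_pos)
  refine ⟨t, ?_⟩
  rw [abs_pow]
  have h1 : |w t| ≤ 1 := (ht.trans_le (min_le_right _ _)).le
  calc |w t| ^ 3 ≤ |w t| ^ 1 := pow_le_pow_of_le_one (abs_nonneg _) h1 (by norm_num)
    _ < c := by simpa using ht.trans_le (min_le_left _ _)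

lemma enorm_pow_three_le_of_eq_zero {w : ℝ → ℝ} (hw : Differentiable ℝ w) {a b s t : ℝ}
    (ht : t ∈ Set.Ioc a b) (hs : s ∈ Set.Ioc a b) (h0 : w t = 0) :
    ‖w s‖ₑ ^ 3 ≤ 3 * ∫⁻ r in Set.Ioc a b, ‖w r‖ₑ ^ 2 * ‖deriv w r‖ₑ := by
  rw [← enorm_pow, ← lintegral_const_mul' _ _ (by norm_num)]
  simp_rw [← enorm_pow_three_deriv hw]
  have h1 := enorm_sub_le_lintegral_deriv (g := fun t => w t ^ 3) (hw.pow 3) t s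
  simp only [h0, ne_eq, OfNat.ofNat_ne_zero, not_false_eq_true, zero_pow, sub_zero] at h1
  refine h1.trans (lintegral_mono_set fun x hx => ?_)
  rw [Set.mem_uIoc] at hx
  rcases hx with hx | hx
  · exact ⟨ht.1.trans hx.1, hx.2.trans hs.2⟩
  · exact ⟨hs.1.trans hx.1, hx.2.trans ht.2⟩

/-- Almost every coordinate line of an integrable function is integrable. -/
lemma ae_lintegral_update_ne_top {n : ℕ} {μ : Fin (n + 1) → Measure ℝ} [∀ i, SigmaFinite (μ i)]
    {H : (Fin (n + 1) → ℝ) → ENNReal} (hH : Measurable H) (hfin : ∫⁻ p, H p ∂Measure.pi μ ≠ ⊤)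
    (i : Fin (n + 1)) :
    ∀ᵐ p ∂Measure.pi μ, ∫⁻ t, H (Function.update p i t) ∂μ i ≠ ⊤ := by
  have hmp := measurePreserving_piFinSuccAbove μ i
  have hmp' := hmp.symm
  set e := MeasurableEquiv.piFinSuccAbove (fun _ : Fin (n + 1) => ℝ) i
  rw [← hmp'.lintegral_comp hH, lintegral_prod_symm _ (by fun_prop)] at hfin
  have h1 := ae_lt_top (Measurable.lintegral_prod_left' (hH.comp e.symm.measurable)) hfin
  have h2 := (Measure.quasiMeasurePreserving_snd.comp hmp.quasiMeasurePreserving).ae h1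
  filter_upwards [h2] with p hp
  convert hp.ne using 2
  ext t
  simp only [Function.comp]
  congr 1
  ext j
  refine Fin.succAboveCases i ?_ (fun k => ?_) j
  · rw [Function.update_self]
    exact (Fin.insertNth_apply_same (α := fun _ => ℝ) i t (i.removeNth p)).symm
  · rw [Function.update_of_ne (Fin.succAbove_ne i k)]
    exact (Fin.insertNth_apply_succAbove (α := fun _ => ℝ) i t (i.removeNth p) k).symm

lemma lintegral_mul_sq_le {α : Type*} [MeasurableSpace α] {μ : Measure α} {f g : α → ENNReal}
    (hf : AEMeasurable f μ) (hg : AEMeasurable g μ) :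
    (∫⁻ a, f a * g a ∂μ) ^ 2 ≤ (∫⁻ a, f a ^ 2 ∂μ) * ∫⁻ a, g a ^ 2 ∂μ := by
  have h := ENNReal.lintegral_mul_le_Lp_mul_Lq μ Real.HolderConjugate.two_two hf hg
  calc (∫⁻ a, f a * g a ∂μ) ^ 2 ≤ _ := pow_le_pow_left' h 2
    _ = _ := by
      rw [mul_pow, ← ENNReal.rpow_natCast, ← ENNReal.rpow_natCast, ← ENNReal.rpow_mul,
        ← ENNReal.rpow_mul]
      norm_num

/-- The Gagliardo–Nirenberg argument in dimension four, starting from a bound along every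
coordinate line. -/
lemma lintegral_pow_four_pow_three_le {μ : Fin 4 → Measure ℝ} [∀ i, SigmaFinite (μ i)]
    {w F : (Fin 4 → ℝ) → ENNReal} (hF : Measurable F) {c : Fin 4 → ENNReal} (hc : ∀ i, c i ≠ ⊤)
    (h : ∀ᵐ p ∂Measure.pi μ, ∀ i, w p ^ 3 ≤ c i * ∫⁻ t, F (Function.update p i t) ∂μ i) :
    (∫⁻ p, w p ^ 4 ∂Measure.pi μ) ^ 3 ≤ (∏ i, c i) * (∫⁻ p, F p ∂Measure.pi μ) ^ 4 := by
  have hgrid := lintegral_mul_prod_lintegral_pow_le μ (p := 1 / 3) (by norm_num)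
    (by simp; norm_num) hF
  have hle : ∫⁻ p, w p ^ 4 ∂Measure.pi μ ≤
      (∏ i, c i ^ (1 / 3 : ℝ)) * (∫⁻ p, F p ∂Measure.pi μ) ^ (1 + 1 / 3 : ℝ) := by
    refine le_trans ?_ (mul_le_mul_right hgrid _)
    rw [← lintegral_const_mul' _ _
      (ENNReal.prod_ne_top fun i _ => ENNReal.rpow_ne_top_of_nonneg (by norm_num) (hc i))]
    refine lintegral_mono_ae ?_
    filter_upwards [h] with p hp
    have h1 : (1 - ((Fintype.card (Fin 4) : ℝ) - 1) * (1 / 3)) = 0 := by simp; norm_num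
    rw [h1, ENNReal.rpow_zero, one_mul, ← Finset.prod_mul_distrib]
    have h2 : w p ^ 4 = ∏ _i : Fin 4, w p := by simp
    rw [h2]
    refine Finset.prod_le_prod' fun i _ => ?_
    rw [← ENNReal.mul_rpow_of_nonneg _ _ (by norm_num : (0 : ℝ) ≤ 1 / 3)]
    calc w p = (w p ^ 3) ^ (1 / 3 : ℝ) := by
          rw [← ENNReal.rpow_natCast, ← ENNReal.rpow_mul]; norm_num
      _ ≤ _ := ENNReal.rpow_le_rpow (hp i) (by norm_num)
  calc (∫⁻ p, w p ^ 4 ∂Measure.pi μ) ^ 3 ≤ _ := pow_le_pow_left' hle 3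
    _ = _ := by
      rw [mul_pow, ← Finset.prod_pow]
      congr 1
      · refine Finset.prod_congr rfl fun i _ => ?_
        rw [← ENNReal.rpow_natCast, ← ENNReal.rpow_mul]; norm_num
      · rw [← ENNReal.rpow_natCast, ← ENNReal.rpow_mul, ← ENNReal.rpow_natCast]; norm_num

lemma volume_restrict_Dom :
    (volume : Measure Pt).restrict Dom =
      (volume : Measure (Fin 3 → ℝ)).prod (volume.restrict (Set.Ioc 0 (2 * π))) := by
  rw [Dom, Measure.volume_eq_prod, ← Measure.prod_restrict, Measure.restrict_univ]

/-- The coordinate measures on the waveguide, the periodic coordinate coming first. -/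
def coordMeasure (i : Fin 4) : Measure ℝ :=
  if i = 0 then volume.restrict (Set.Ioc 0 (2 * π)) else volume

instance (i : Fin 4) : SigmaFinite (coordMeasure i) := by
  unfold coordMeasure; split_ifs <;> infer_instance

/-- Regroup four coordinates as a point of the waveguide. -/
def regroup (p : Fin 4 → ℝ) : Pt := (fun j => p j.succ, p 0)

lemma measurePreserving_regroup :
    MeasurePreserving regroup (Measure.pi coordMeasure) (volume.restrict Dom) := by
  have h := (Measure.measurePreserving_swap).comp (measurePreserving_piFinSuccAbove coordMeasure 0)
  have h1 : (fun j : Fin 3 => coordMeasure (Fin.succAbove 0 j)) = fun _ => volume := by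
    ext1 j; simp [coordMeasure]
  have h2 : coordMeasure 0 = volume.restrict (Set.Ioc 0 (2 * π)) := by simp [coordMeasure]
  rw [h1, h2, ← volume_pi, ← volume_restrict_Dom] at h
  exact h

lemma regroup_update_zero (p : Fin 4 → ℝ) (t : ℝ) :
    regroup (Function.update p 0 t) = ((regroup p).1, t) := by
  simp [regroup]

lemma regroup_update_succ (p : Fin 4 → ℝ) (k : Fin 3) (t : ℝ) :
    regroup (Function.update p k.succ t) =
      (Function.update (regroup p).1 k t, (regroup p).2) := by
  refine Prod.ext (funext fun j => ?_) ?_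
  · simp [regroup, Function.update_apply]
  · simp [regroup, Function.update_apply, (Fin.succ_ne_zero k).symm]

lemma hasDerivAt_line_x {W : Pt → ℝ} (hW : Differentiable ℝ W) (x : Fin 3 → ℝ) (y : ℝ)
    (k : Fin 3) (t : ℝ) :
    HasDerivAt (fun t => W (Function.update x k t, y)) (gradx W (Function.update x k t, y) k) t := by
  have h1 := (hasDerivAt_update x k t).prodMk (hasDerivAt_const t y)
  have h2 := (hW (Function.update x k t, y)).hasFDerivAt.comp_hasDerivAt t h1
  convert! h2 using 1
  unfold gradx ex
  congr 2
  ext j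
  simp [Pi.single_apply]

lemma hasDerivAt_line_y {W : Pt → ℝ} (hW : Differentiable ℝ W) (x : Fin 3 → ℝ) (t : ℝ) :
    HasDerivAt (fun t => W (x, t)) (grady W (x, t)) t :=
  (hW (x, t)).hasFDerivAt.comp_hasDerivAt t ((hasDerivAt_const t x).prodMk (hasDerivAt_id t))

lemma measurable_gradx (W : Pt → ℝ) (i : Fin 3) : Measurable fun p => gradx W p i :=
  measurable_fderiv_apply_const ℝ W (ex i)

lemma measurable_grady (W : Pt → ℝ) : Measurable (grady W) :=
  measurable_fderiv_apply_const ℝ W ey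

lemma measurable_gradSqX (W : Pt → ℝ) : Measurable (gradSqX W) :=
  Finset.measurable_sum _ fun i _ => (measurable_gradx W i).pow_const 2

lemma gradSqX_nonneg (W : Pt → ℝ) (p : Pt) : 0 ≤ gradSqX W p :=
  Finset.sum_nonneg fun _ _ => sq_nonneg _

lemma abs_gradx_le (W : Pt → ℝ) (p : Pt) (i : Fin 3) {b : ℝ} (hb : 0 ≤ b) :
    |gradx W p i| ≤ √(gradSqX W p + b) := by
  rw [← Real.sqrt_sq_eq_abs]
  refine Real.sqrt_le_sqrt ?_
  have h : gradx W p i ^ 2 ≤ gradSqX W p :=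
    Finset.single_le_sum (f := fun i => gradx W p i ^ 2) (fun _ _ => sq_nonneg _)
      (Finset.mem_univ i)
  linarith

/-- Anisotropic critical Sobolev inequality on the waveguide for functions vanishing on a slice. -/
lemma setIntegral_pow_four_le {W : Pt → ℝ} (hW : Differentiable ℝ W) {y₀ : ℝ}
    (hy₀ : y₀ ∈ Set.Ioc 0 (2 * π)) (h0 : ∀ x, W (x, y₀) = 0)
    (h4 : IntegrableOn (fun p => W p ^ 4) Dom) (hX : IntegrableOn (gradSqX W) Dom)
    (hY : IntegrableOn (fun p => grady W p ^ 2) Dom) {s : ℝ} (hs : 0 < s) :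
    ∫ p in Dom, W p ^ 4 ≤
      81 / s * ((∫ p in Dom, gradSqX W p) + s ^ 2 * ∫ p in Dom, grady W p ^ 2) ^ 2 := by
  set D : Pt → ℝ := fun p => √(gradSqX W p + s ^ 2 * grady W p ^ 2) with hD
  have hDm : Measurable D :=
    ((measurable_gradSqX W).add (((measurable_grady W).pow_const 2).const_mul _)).sqrt
  have hWm : Measurable W := hW.continuous.measurable
  have hx : ∀ p i, ‖gradx W p i‖ₑ ≤ ‖D p‖ₑ := fun p i => by
    rw [enorm_le_iff_norm_le, Real.norm_eq_abs, Real.norm_of_nonneg (Real.sqrt_nonneg _)]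
    exact abs_gradx_le W p i (by positivity)
  have hy : ∀ p, ‖grady W p‖ₑ ≤ ENNReal.ofReal s⁻¹ * ‖D p‖ₑ := fun p => by
    rw [← ofReal_norm, ← ofReal_norm, ← ENNReal.ofReal_mul (by positivity)]
    refine ENNReal.ofReal_le_ofReal ?_
    rw [Real.norm_eq_abs, Real.norm_of_nonneg (Real.sqrt_nonneg _), le_inv_mul_iff₀ hs]
    calc s * |grady W p| = √(s ^ 2 * grady W p ^ 2) := by
          rw [← mul_pow, Real.sqrt_sq_eq_abs, abs_mul, abs_of_pos hs]
      _ ≤ _ := Real.sqrt_le_sqrt (by linarith [gradSqX_nonneg W p])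
  set F : Pt → ENNReal := fun p => ‖W p‖ₑ ^ 2 * ‖D p‖ₑ with hF
  have hFm : Measurable F := (hWm.enorm.pow_const 2).mul hDm.enorm
  have hmp := measurePreserving_regroup
  have hfin : ∫⁻ p in Dom, ‖W p‖ₑ ^ 4 ≠ ⊤ := by
    have := h4.2.ne
    simpa only [enorm_pow] using this
  have hfin' : ∫⁻ p, ‖W (regroup p)‖ₑ ^ 4 ∂Measure.pi coordMeasure ≠ ⊤ := by
    rwa [hmp.lintegral_comp (f := fun p => ‖W p‖ₑ ^ 4) (hWm.enorm.pow_const 4)]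
  have hlines : ∀ᵐ p ∂Measure.pi coordMeasure, ∀ i, ‖W (regroup p)‖ₑ ^ 3 ≤
      (if i = 0 then 3 * ENNReal.ofReal s⁻¹ else 3) *
        ∫⁻ t, F (regroup (Function.update p i t)) ∂coordMeasure i := by
    have hline := ae_all_iff.2 (ae_lintegral_update_ne_top (μ := coordMeasure)
      (H := fun p => ‖W (regroup p)‖ₑ ^ 4)
      ((hWm.comp hmp.measurable).enorm.pow_const 4) hfin')
    have hmem : ∀ᵐ p ∂Measure.pi coordMeasure, (regroup p).2 ∈ Set.Ioc 0 (2 * π) := by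
      refine hmp.quasiMeasurePreserving.ae (p := fun q : Pt => q.2 ∈ Set.Ioc 0 (2 * π)) ?_
      refine ae_restrict_of_forall_mem (MeasurableSet.univ.prod measurableSet_Ioc) ?_
      exact fun q hq => hq.2
    filter_upwards [hline, hmem] with p hp hp2 i
    refine Fin.cases ?_ (fun k => ?_) i
    · have hd : Differentiable ℝ fun t => W ((regroup p).1, t) := fun t =>
        (hasDerivAt_line_y hW _ t).differentiableAt
      have h1 := enorm_pow_three_le_of_eq_zero hd hy₀ hp2 (h0 _)
      simp only [if_true, regroup_update_zero, coordMeasure]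
      refine h1.trans ?_
      rw [mul_assoc, ← lintegral_const_mul' _ _ ENNReal.ofReal_ne_top]
      refine mul_le_mul_right (lintegral_mono fun t => ?_) _
      rw [(hasDerivAt_line_y hW _ t).deriv, hF]
      simp only
      rw [mul_left_comm]
      gcongr
      exact hy _
    · have hd : Differentiable ℝ fun t => W (Function.update (regroup p).1 k t, (regroup p).2) :=
        fun t => (hasDerivAt_line_x hW _ _ k t).differentiableAt
      have hpk : ∫⁻ t, ‖W (regroup (Function.update p k.succ t))‖ₑ ^ 4 ∂coordMeasure k.succ ≠ ⊤ :=
        hp k.succ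
      simp only [regroup_update_succ, coordMeasure, Fin.succ_ne_zero, if_false] at hpk ⊢
      have h1 := enorm_pow_three_le hd hpk ((regroup p).1 k)
      simp only [Function.update_eq_self] at h1
      refine h1.trans ?_
      refine mul_le_mul_right (lintegral_mono fun t => ?_) _
      rw [(hasDerivAt_line_x hW _ _ k t).deriv]
      exact mul_le_mul_right (hx _ _) _
  have key := lintegral_pow_four_pow_three_le (hFm.comp hmp.measurable)
    (fun i => by split_ifs <;> finiteness) hlines
  simp only [Function.comp] at key
  rw [hmp.lintegral_comp (f := fun p => ‖W p‖ₑ ^ 4) (hWm.enorm.pow_const 4),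
    hmp.lintegral_comp hFm] at key
  have hcs := lintegral_mul_sq_le (μ := volume.restrict Dom) (f := fun p => ‖W p‖ₑ ^ 2)
    (g := fun p => ‖D p‖ₑ) (hWm.enorm.pow_const 2).aemeasurable hDm.enorm.aemeasurable
  have hI4 : ENNReal.ofReal (∫ p in Dom, W p ^ 4) = ∫⁻ p in Dom, ‖W p‖ₑ ^ 4 := by
    rw [ofReal_integral_eq_lintegral_ofReal h4 (ae_of_all _ fun p => by positivity)]
    refine lintegral_congr fun p => ?_
    rw [← enorm_pow, Real.enorm_of_nonneg (by positivity)]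
  have hID : ENNReal.ofReal ((∫ p in Dom, gradSqX W p) + s ^ 2 * ∫ p in Dom, grady W p ^ 2) =
      ∫⁻ p in Dom, ‖D p‖ₑ ^ 2 := by
    rw [← integral_const_mul, ← integral_add (f := fun p => gradSqX W p) hX (hY.const_mul _),
      ofReal_integral_eq_lintegral_ofReal (f := fun p => gradSqX W p + s ^ 2 * grady W p ^ 2)
        (Integrable.add (f := fun p => gradSqX W p) hX (hY.const_mul _))
        (ae_of_all _ fun p => add_nonneg (gradSqX_nonneg W p) (by positivity))]
    refine lintegral_congr fun p => ?_
    rw [← enorm_pow, Real.enorm_of_nonneg (by positivity), hD, Real.sq_sqrt]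
    exact add_nonneg (gradSqX_nonneg W p) (by positivity)
  have hprod : (∏ i : Fin 4, (if i = 0 then 3 * ENNReal.ofReal s⁻¹ else 3 : ENNReal)) =
      ENNReal.ofReal (81 / s) := by
    simp [Fin.prod_univ_four]
    rw [ENNReal.ofReal_div_of_pos hs, ENNReal.ofReal_inv_of_pos hs, div_eq_mul_inv,
      ENNReal.ofReal_ofNat]
    ring
  set I := ∫ p in Dom, W p ^ 4 with hIdef
  set E := (∫ p in Dom, gradSqX W p) + s ^ 2 * ∫ p in Dom, grady W p ^ 2 with hEdef
  have hI0 : 0 ≤ I := integral_nonneg fun p => by positivity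
  have hE0 : 0 ≤ E := add_nonneg (integral_nonneg fun p => gradSqX_nonneg W p)
    (mul_nonneg (by positivity) (integral_nonneg fun p => by positivity))
  simp only [← pow_mul] at hcs
  norm_num only at hcs
  rw [← hI4, ← hID, ← ENNReal.ofReal_mul hI0] at hcs
  rw [hprod, ← hI4, (by ring : (∫⁻ p in Dom, F p) ^ 4 = ((∫⁻ p in Dom, F p) ^ 2) ^ 2)] at key
  have key2 := key.trans (mul_le_mul_right (pow_le_pow_left' hcs 2) _)
  rw [← ENNReal.ofReal_pow hI0, ← ENNReal.ofReal_pow (by positivity),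
    ← ENNReal.ofReal_mul (by positivity), ENNReal.ofReal_le_ofReal_iff (by positivity)] at key2
  rcases hI0.eq_or_lt with h | h
  · rw [← h]; positivity
  · refine le_of_mul_le_mul_left ?_ (by positivity : 0 < I ^ 2)
    calc I ^ 2 * I = I ^ 3 := by ring
      _ ≤ _ := key2
      _ = _ := by ring

lemma gradSq3_nonneg (f : Pt3 → ℝ) (x : Pt3) : 0 ≤ gradSq3 f x :=
  Finset.sum_nonneg fun _ _ => sq_nonneg _

lemma nonlin3_eq (f g : Pt3 → ℝ) (x : Pt3) : nonlin3 f g x = (f x ^ 2 + g x ^ 2) ^ 2 := by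
  unfold nonlin3; ring

lemma H1R3.integrable_nonlin3 {f g : Pt3 → ℝ} (hf : H1R3 f) (hg : H1R3 g) :
    Integrable (nonlin3 f g) := by
  refine ((hf.memL4.add hg.memL4).const_mul 2).mono' ?_ (ae_of_all _ fun x => ?_)
  · have h1 := hf.diff.continuous
    have h2 := hg.diff.continuous
    unfold nonlin3
    exact Continuous.aestronglyMeasurable (by fun_prop)
  · rw [nonlin3_eq, Real.norm_of_nonneg (by positivity)]
    simp only [Pi.add_apply]
    nlinarith [sq_nonneg (f x ^ 2 - g x ^ 2)]

lemma hasDerivAt_line3 {f : Pt3 → ℝ} (hf : Differentiable ℝ f) (x : Pt3) (k : Fin 3) (t : ℝ) :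
    HasDerivAt (fun t => f (Function.update x k t)) (grad3 f (Function.update x k t) k) t := by
  have h2 := (hf (Function.update x k t)).hasFDerivAt.comp_hasDerivAt t (hasDerivAt_update x k t)
  convert! h2 using 1
  unfold grad3 e3
  congr 1
  ext j
  simp [Pi.single_apply]

lemma H1R3.integral_gradSq3_pos {f : Pt3 → ℝ} (hf : H1R3 f) (hpos : 0 < ∫ x, f x ^ 2) :
    0 < ∫ x, gradSq3 f x := by
  by_contra hcon
  have h0 : ∫ x, gradSq3 f x = 0 :=
    le_antisymm (not_lt.1 hcon) (integral_nonneg (gradSq3_nonneg f))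
  rw [integral_eq_zero_iff_of_nonneg (gradSq3_nonneg f) hf.memGrad] at h0
  have hm : Measurable fun x => grad3 f x 0 := measurable_fderiv_apply_const ℝ f (e3 0)
  have hgrad : ∀ᵐ x : Pt3, ‖grad3 f x 0‖ₑ = 0 := by
    filter_upwards [h0] with x hx
    have h := (Finset.sum_eq_zero_iff_of_nonneg (fun i _ => sq_nonneg (grad3 f x i))).1 hx 0
      (Finset.mem_univ 0)
    simpa using h
  have hzero : ∫⁻ x : Pt3, ⊤ * ‖grad3 f x 0‖ₑ = 0 := by
    rw [lintegral_eq_zero_iff (by fun_prop)]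
    filter_upwards [hgrad] with x hx
    simp [hx]
  have hl1 := ae_lintegral_update_ne_top (n := 2) (μ := fun _ => volume)
    (H := fun x => ⊤ * ‖grad3 f x 0‖ₑ) (by fun_prop) (by rw [← volume_pi, hzero]; simp) 0
  have hl2 := ae_lintegral_update_ne_top (n := 2) (μ := fun _ => volume)
    (H := fun x => ‖f x‖ₑ ^ 2) (hf.diff.continuous.measurable.enorm.pow_const 2)
    (by
      rw [← volume_pi]
      simpa only [enorm_pow] using hf.memL2.2.ne) 0
  rw [← volume_pi] at hl1 hl2
  have hf0 : ∀ᵐ x : Pt3, f x ^ 2 = 0 := by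
    filter_upwards [hl1, hl2] with x hx1 hx2
    have hd : Differentiable ℝ fun t => f (Function.update x 0 t) := fun t =>
      (hasDerivAt_line3 hf.diff x 0 t).differentiableAt
    have h1 := enorm_le_lintegral_deriv hd
      (fun c hc => exists_abs_lt_of_lintegral_ne_top hx2 hc) (x 0)
    simp only [Function.update_eq_self, (hasDerivAt_line3 hf.diff x 0 _).deriv] at h1
    rw [lintegral_const_mul _ (by fun_prop)] at hx1
    have h2 : ∫⁻ t, ‖grad3 f (Function.update x 0 t) 0‖ₑ = 0 := by
      by_contra h
      exact hx1 (ENNReal.top_mul h)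
    rw [h2] at h1
    have h3 : f x = 0 := by simpa using h1
    rw [h3]; norm_num
  rw [integral_congr_ae hf0] at hpos
  simp at hpos

lemma H1R3.integral_nonlin3_pos {f g : Pt3 → ℝ} (hf : H1R3 f) (hg : H1R3 g)
    (hpos : 0 < ∫ x, f x ^ 2) : 0 < ∫ x, nonlin3 f g x := by
  have h4 : 0 < ∫ x, f x ^ 4 := by
    rw [integral_pos_iff_support_of_nonneg (fun x => by positivity) hf.memL4]
    rw [integral_pos_iff_support_of_nonneg (fun x => by positivity) hf.memL2] at hpos
    convert hpos using 2
    ext x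
    simp
  refine h4.trans_le (integral_mono hf.memL4 (hf.integrable_nonlin3 hg) fun x => ?_)
  simp only [nonlin3]
  nlinarith [sq_nonneg (f x * g x), sq_nonneg (g x ^ 2)]

lemma fderiv_const_mul3 {f : Pt3 → ℝ} (hf : Differentiable ℝ f) (c : ℝ) (x : Pt3) (i : Fin 3) :
    grad3 (fun x => c * f x) x i = c * grad3 f x i := by
  unfold grad3
  rw [fderiv_const_mul (hf x)]
  simp

lemma gradSq3_const_mul {f : Pt3 → ℝ} (hf : Differentiable ℝ f) (c : ℝ) (x : Pt3) :
    gradSq3 (fun x => c * f x) x = c ^ 2 * gradSq3 f x := by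
  unfold gradSq3
  rw [Finset.mul_sum]
  exact Finset.sum_congr rfl fun i _ => by rw [fderiv_const_mul3 hf, mul_pow]

lemma H1R3.const_mul {f : Pt3 → ℝ} (hf : H1R3 f) (c : ℝ) : H1R3 fun x => c * f x where
  diff := hf.diff.const_mul c
  memL2 := by simpa only [mul_pow] using hf.memL2.const_mul (c ^ 2)
  memGrad := by simpa only [gradSq3_const_mul hf.diff] using hf.memGrad.const_mul (c ^ 2)
  memL4 := by simpa only [mul_pow] using hf.memL4.const_mul (c ^ 4)

lemma gradSq3_comp_smul {f : Pt3 → ℝ} (hf : Differentiable ℝ f) (τ : ℝ) (x : Pt3) :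
    gradSq3 (fun x => f (τ • x)) x = τ ^ 2 * gradSq3 f (τ • x) := by
  unfold gradSq3
  rw [Finset.mul_sum]
  refine Finset.sum_congr rfl fun i _ => ?_
  have h : HasFDerivAt (fun x => f (τ • x))
      ((fderiv ℝ f (τ • x)).comp (τ • ContinuousLinearMap.id ℝ Pt3)) x :=
    (hf (τ • x)).hasFDerivAt.comp x ((hasFDerivAt_id x).const_smul τ)
  unfold grad3
  rw [h.fderiv]
  simp [mul_pow]

lemma H1R3.comp_smul {f : Pt3 → ℝ} (hf : H1R3 f) {τ : ℝ} (hτ : τ ≠ 0) :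
    H1R3 fun x => f (τ • x) where
  diff := hf.diff.comp (differentiable_id.const_smul τ)
  memL2 := hf.memL2.comp_smul hτ
  memGrad := by
    simpa only [gradSq3_comp_smul hf.diff] using (hf.memGrad.comp_smul hτ).const_mul (τ ^ 2)
  memL4 := hf.memL4.comp_smul hτ

lemma integral_comp_smul3 (F : Pt3 → ℝ) {τ : ℝ} (hτ : 0 < τ) :
    ∫ x, F (τ • x) = (τ ^ 3)⁻¹ * ∫ x, F x := by
  rw [Measure.integral_comp_smul_of_nonneg volume F τ (hR := hτ.le)]
  simp

/-- Every admissible pair can be dilated onto the constraint `Q̂ = 0`. -/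
lemma exists_Qhat_eq_zero {f g : Pt3 → ℝ} (hf : H1R3 f) (hg : H1R3 g)
    (hG : 0 < ∫ x, (gradSq3 f x + gradSq3 g x)) (hN : 0 < ∫ x, nonlin3 f g x) :
    ∃ u v : Pt3 → ℝ, H1R3 u ∧ H1R3 v ∧ l2R3 u = l2R3 f ∧ l2R3 v = l2R3 g ∧ Qhat u v = 0 ∧
      Ihat u v = 8 * (∫ x, (gradSq3 f x + gradSq3 g x)) ^ 3 / (27 * (∫ x, nonlin3 f g x) ^ 2) := by
  set G := ∫ x, (gradSq3 f x + gradSq3 g x) with hGdef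
  set N := ∫ x, nonlin3 f g x with hNdef
  set τ := 4 * G / (3 * N) with hτdef
  have hτ : 0 < τ := by positivity
  set c := √(τ ^ 3) with hcdef
  have hc2 : c ^ 2 = τ ^ 3 := Real.sq_sqrt (by positivity)
  have hmass : ∀ h : Pt3 → ℝ, l2R3 (fun x => c * h (τ • x)) = l2R3 h := fun h => by
    unfold l2R3
    congr 1
    simp only [mul_pow]
    rw [integral_const_mul, integral_comp_smul3 (fun x => h x ^ 2) hτ, hc2]
    field_simp
  have hgr : ∀ {h : Pt3 → ℝ}, H1R3 h → ∀ x,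
      gradSq3 (fun x => c * h (τ • x)) x = τ ^ 5 * gradSq3 h (τ • x) := fun {h} hh x => by
    rw [gradSq3_const_mul (hh.comp_smul hτ.ne').diff, gradSq3_comp_smul hh.diff, hc2]
    ring
  have hG' : ∫ x, (gradSq3 (fun x => c * f (τ • x)) x + gradSq3 (fun x => c * g (τ • x)) x) =
      τ ^ 2 * G := by
    simp only [hgr hf, hgr hg, ← mul_add]
    rw [integral_const_mul, integral_comp_smul3 (fun x => gradSq3 f x + gradSq3 g x) hτ]
    field_simp
    rfl
  have hN' : ∫ x, nonlin3 (fun x => c * f (τ • x)) (fun x => c * g (τ • x)) x = τ ^ 3 * N := by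
    have : ∀ x, nonlin3 (fun x => c * f (τ • x)) (fun x => c * g (τ • x)) x =
        τ ^ 6 * nonlin3 f g (τ • x) := fun x => by
      unfold nonlin3
      rw [(by ring : τ ^ 6 = (τ ^ 3) ^ 2), ← hc2]
      ring
    simp only [this]
    rw [integral_const_mul, integral_comp_smul3 (fun x => nonlin3 f g x) hτ]
    field_simp
    rfl
  refine ⟨_, _, (hf.comp_smul hτ.ne').const_mul c, (hg.comp_smul hτ.ne').const_mul c,
    hmass f, hmass g, ?_, ?_⟩
  · unfold Qhat
    rw [hG', hN', hτdef]
    field_simp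
    ring
  · unfold Ihat
    rw [hG', hN', hτdef]
    field_simp
    ring

lemma Ihat_eq {u v : Pt3 → ℝ} (h : Qhat u v = 0) :
    Ihat u v = (∫ x, (gradSq3 u x + gradSq3 v x)) / 6 := by
  unfold Qhat at h
  unfold Ihat
  linarith

lemma Ihat_nonneg {u v : Pt3 → ℝ} (h : Qhat u v = 0) : 0 ≤ Ihat u v := by
  rw [Ihat_eq h]
  have : 0 ≤ ∫ x, (gradSq3 u x + gradSq3 v x) :=
    integral_nonneg fun x => add_nonneg (gradSq3_nonneg u x) (gradSq3_nonneg v x)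
  positivity

lemma mhat_nonneg (ρ : ℝ) : 0 ≤ mhat ρ := by
  refine Real.sInf_nonneg ?_
  rintro c ⟨u, v, _, _, _, _, hQ, rfl⟩
  exact Ihat_nonneg hQ

lemma mhat_le {ρ : ℝ} {u v : Pt3 → ℝ} (hu : H1R3 u) (hv : H1R3 v) (hu2 : l2R3 u = ρ)
    (hv2 : l2R3 v = ρ) (hQ : Qhat u v = 0) : mhat ρ ≤ Ihat u v := by
  refine csInf_le ⟨0, ?_⟩ ⟨u, v, hu, hv, hu2, hv2, hQ, rfl⟩
  rintro c ⟨u, v, _, _, _, _, hQ, rfl⟩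
  exact Ihat_nonneg hQ

lemma l2R3_const_mul (f : Pt3 → ℝ) {c : ℝ} (hc : 0 ≤ c) :
    l2R3 (fun x => c * f x) = c * l2R3 f := by
  unfold l2R3
  simp only [mul_pow]
  rw [integral_const_mul, Real.sqrt_mul (by positivity), Real.sqrt_sq hc]

lemma exists_H1R3_integral_sq_pos : ∃ b : Pt3 → ℝ, H1R3 b ∧ 0 < ∫ x, b x ^ 2 := by
  obtain ⟨b, -, hbc, hbs, -, hb0⟩ :=
    exists_contDiff_tsupport_subset (s := Set.univ) (x := (0 : Pt3)) (n := 1) Filter.univ_mem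
  have hc : ∀ n : ℕ, Continuous fun x => b x ^ n := fun n => hbs.continuous.pow n
  have hpow : ∀ n : ℕ, n ≠ 0 → HasCompactSupport fun x => b x ^ n := fun n hn =>
    hbc.comp_left (g := fun t : ℝ => t ^ n) (zero_pow hn)
  refine ⟨b, ⟨hbs.differentiable (by norm_num), ?_, ?_, ?_⟩, ?_⟩
  · exact (hc 2).integrable_of_hasCompactSupport (hpow 2 two_ne_zero)
  · refine Continuous.integrable_of_hasCompactSupport ?_ ?_
    · have := hbs.continuous_fderiv (by norm_num)
      unfold gradSq3 grad3
      fun_prop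
    · exact (hbc.fderiv (𝕜 := ℝ)).comp_left
        (g := fun L : Pt3 →L[ℝ] ℝ => ∑ i, (L (e3 i)) ^ 2) (by simp)
  · exact (hc 4).integrable_of_hasCompactSupport (hpow 4 four_ne_zero)
  · refine (hc 2).integral_pos_of_hasCompactSupport_nonneg_nonzero (hpow 2 two_ne_zero)
      (fun x => by positivity) (x := 0) ?_
    simp [hb0]

lemma mhat_set_nonempty {ρ : ℝ} (hρ : 0 < ρ) :
    {c | ∃ u v : Pt3 → ℝ, H1R3 u ∧ H1R3 v ∧ l2R3 u = ρ ∧ l2R3 v = ρ ∧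
      Qhat u v = 0 ∧ Ihat u v = c}.Nonempty := by
  obtain ⟨b, hb, hpos⟩ := exists_H1R3_integral_sq_pos
  have hl : 0 < l2R3 b := Real.sqrt_pos.2 hpos
  have hG : 0 < ∫ x, (gradSq3 b x + gradSq3 b x) := by
    rw [integral_add hb.memGrad hb.memGrad]
    linarith [hb.integral_gradSq3_pos hpos]
  set c := ρ / l2R3 b with hc
  have hc0 : 0 < c := by positivity
  have hf := hb.const_mul c
  have hfl : l2R3 (fun x => c * b x) = ρ := by
    rw [l2R3_const_mul _ hc0.le, hc]; field_simp
  have hfpos : 0 < ∫ x, (c * b x) ^ 2 := by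
    rw [← Real.sqrt_pos]
    change 0 < l2R3 (fun x => c * b x)
    rw [hfl]; exact hρ
  obtain ⟨u, v, hu, hv, hul, hvl, hQ, hI⟩ := exists_Qhat_eq_zero hf hf
    (by
      rw [integral_add hf.memGrad hf.memGrad]
      linarith [hf.integral_gradSq3_pos hfpos]) (hf.integral_nonlin3_pos hf hfpos)
  exact ⟨_, u, v, hu, hv, hul.trans hfl, hvl.trans hfl, hQ, rfl⟩

/-- The sharp Gagliardo–Nirenberg inequality encoded by `mhat`, for pairs of approximately correct
mass. -/
lemma mhat_mul_sq_le {f g : Pt3 → ℝ} (hf : H1R3 f) (hg : H1R3 g) {l : ℝ} (hl1 : l < 1)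
    (hMf : |2 * π * (∫ x, f x ^ 2) - 1| ≤ l) (hMg : |2 * π * (∫ x, g x ^ 2) - 1| ≤ l) :
    mhat (1 / √(2 * π)) * (∫ x, nonlin3 f g x) ^ 2 ≤
      8 / 27 * ((1 + l) ^ 4 / (1 - l) ^ 3) * (∫ x, (gradSq3 f x + gradSq3 g x)) ^ 3 := by
  have hl0 : 0 ≤ l := (abs_nonneg _).trans hMf
  have h1l : 0 < 1 - l := by linarith
  have hamp : ∀ {h : Pt3 → ℝ}, |2 * π * (∫ x, h x ^ 2) - 1| ≤ l → 0 < ∫ x, h x ^ 2 ∧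
      ∃ c : ℝ, 0 < c ∧ l2R3 (fun x => c * h x) = 1 / √(2 * π) ∧ (1 + l)⁻¹ ≤ c ^ 2 ∧
        c ^ 2 ≤ (1 - l)⁻¹ := fun {h} hh => by
    rw [abs_le] at hh
    have hM : 0 < ∫ x, h x ^ 2 := by
      by_contra hcon
      have := mul_nonpos_of_nonneg_of_nonpos (by positivity : 0 ≤ 2 * π) (not_lt.1 hcon)
      linarith
    refine ⟨hM, (√(2 * π * ∫ x, h x ^ 2))⁻¹, by positivity, ?_, ?_, ?_⟩
    · rw [l2R3_const_mul _ (by positivity), l2R3, Real.sqrt_mul (by positivity)]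
      have := Real.sqrt_pos.2 hM
      field_simp
    · rw [inv_pow, Real.sq_sqrt (by positivity)]
      exact inv_anti₀ (by positivity) (by linarith)
    · rw [inv_pow, Real.sq_sqrt (by positivity)]
      exact inv_anti₀ h1l (by linarith)
  obtain ⟨hf0, a, ha, hal, ha1, ha2⟩ := hamp hMf
  obtain ⟨hg0, b, hb, hbl, hb1, hb2⟩ := hamp hMg
  have hGf := hf.integral_gradSq3_pos hf0
  have hGg := hg.integral_gradSq3_pos hg0
  have hN := hf.integral_nonlin3_pos hg hf0
  have hf' := hf.const_mul a
  have hg' := hg.const_mul b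
  have hGeq : ∫ x, (gradSq3 (fun x => a * f x) x + gradSq3 (fun x => b * g x) x) =
      a ^ 2 * (∫ x, gradSq3 f x) + b ^ 2 * ∫ x, gradSq3 g x := by
    rw [integral_add hf'.memGrad hg'.memGrad]
    simp only [gradSq3_const_mul hf.diff, gradSq3_const_mul hg.diff]
    rw [integral_const_mul, integral_const_mul]
  have hNge : ((1 + l)⁻¹) ^ 2 * ∫ x, nonlin3 f g x ≤
      ∫ x, nonlin3 (fun x => a * f x) (fun x => b * g x) x := by
    rw [← integral_const_mul]
    refine integral_mono ((hf.integrable_nonlin3 hg).const_mul _) (hf'.integrable_nonlin3 hg')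
      fun x => ?_
    simp only [nonlin3_eq]
    rw [← mul_pow, mul_add, mul_pow, mul_pow]
    gcongr
  have hG'pos : 0 < ∫ x, (gradSq3 (fun x => a * f x) x + gradSq3 (fun x => b * g x) x) := by
    rw [hGeq]; positivity
  have hN'pos : 0 < ∫ x, nonlin3 (fun x => a * f x) (fun x => b * g x) x :=
    lt_of_lt_of_le (by positivity) hNge
  obtain ⟨u, v, hu, hv, hul, hvl, hQ, hI⟩ := exists_Qhat_eq_zero hf' hg' hG'pos hN'pos
  have hle := mhat_le hu hv (hul.trans hal) (hvl.trans hbl) hQ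
  rw [hI, le_div_iff₀ (by positivity)] at hle
  have hGle : ∫ x, (gradSq3 (fun x => a * f x) x + gradSq3 (fun x => b * g x) x) ≤
      (1 - l)⁻¹ * ∫ x, (gradSq3 f x + gradSq3 g x) := by
    rw [hGeq, integral_add hf.memGrad hg.memGrad, mul_add]
    gcongr
  have hm := mhat_nonneg (1 / √(2 * π))
  have hN2 := mul_le_mul_of_nonneg_left (pow_le_pow_left₀ (by positivity) hNge 2) hm
  have hG3 := pow_le_pow_left₀ hG'pos.le hGle 3
  have h1 : mhat (1 / √(2 * π)) * (((1 + l)⁻¹) ^ 2 * ∫ x, nonlin3 f g x) ^ 2 ≤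
      8 / 27 * ((1 - l)⁻¹ * ∫ x, (gradSq3 f x + gradSq3 g x)) ^ 3 := by linarith
  calc _ = (1 + l) ^ 4 *
        (mhat (1 / √(2 * π)) * (((1 + l)⁻¹) ^ 2 * ∫ x, nonlin3 f g x) ^ 2) := by
        field_simp
    _ ≤ (1 + l) ^ 4 * (8 / 27 * ((1 - l)⁻¹ * ∫ x, (gradSq3 f x + gradSq3 g x)) ^ 3) := by gcongr
    _ = _ := by field_simp

lemma H1.integrableOn_gradSqX {u : Pt → ℝ} (hu : H1 u) :
    IntegrableOn (fun p => gradSqX u p) Dom := by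
  refine hu.memGrad.mono' (measurable_gradSqX u).aestronglyMeasurable (ae_of_all _ fun p => ?_)
  rw [Real.norm_of_nonneg (gradSqX_nonneg u p), gradSq]
  linarith [sq_nonneg (grady u p)]

lemma H1.integrableOn_grady_sq {u : Pt → ℝ} (hu : H1 u) :
    IntegrableOn (fun p => grady u p ^ 2) Dom := by
  refine hu.memGrad.mono' ((measurable_grady u).pow_const 2).aestronglyMeasurable
    (ae_of_all _ fun p => ?_)
  rw [Real.norm_of_nonneg (sq_nonneg _), gradSq]
  linarith [gradSqX_nonneg u p]

lemma nonlin_eq (u v : Pt → ℝ) (p : Pt) : nonlin u v p = (u p ^ 2 + v p ^ 2) ^ 2 := by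
  unfold nonlin; ring

lemma integrableOn_nonlin {u v : Pt → ℝ} (hu : H1 u) (hv : H1 v) :
    IntegrableOn (nonlin u v) Dom := by
  refine ((hu.memL4.add hv.memL4).const_mul 2).mono' ?_ (ae_of_all _ fun p => ?_)
  · have h1 := hu.diff.continuous
    have h2 := hv.diff.continuous
    unfold nonlin
    exact Continuous.aestronglyMeasurable (by fun_prop)
  · rw [nonlin_eq, Real.norm_of_nonneg (by positivity)]
    simp only [Pi.add_apply]
    nlinarith [sq_nonneg (u p ^ 2 - v p ^ 2)]

lemma integrableOn_Dom_fst {F : Pt3 → ℝ} (hF : Integrable F) :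
    IntegrableOn (fun p : Pt => F p.1) Dom := by
  rw [IntegrableOn, volume_restrict_Dom]
  exact hF.comp_fst _

lemma setIntegral_Dom_fst (F : Pt3 → ℝ) : ∫ p in Dom, F p.1 = 2 * π * ∫ x, F x := by
  rw [volume_restrict_Dom, integral_fun_fst]
  simp [Real.pi_pos.le]

lemma setIntegral_Dom {F : Pt → ℝ} (hF : IntegrableOn F Dom) :
    ∫ p in Dom, F p = ∫ y in Set.Ioc 0 (2 * π), ∫ x, F (x, y) := by
  rw [IntegrableOn, volume_restrict_Dom] at hF
  rw [volume_restrict_Dom, integral_prod_symm _ hF]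

lemma ae_integrable_slice {F : Pt → ℝ} (hF : IntegrableOn F Dom) :
    ∀ᵐ y ∂volume.restrict (Set.Ioc 0 (2 * π)), Integrable fun x => F (x, y) := by
  rw [IntegrableOn, volume_restrict_Dom] at hF
  exact hF.prod_left_ae

lemma integrableOn_integral_slice {F : Pt → ℝ} (hF : IntegrableOn F Dom) :
    IntegrableOn (fun y => ∫ x, F (x, y)) (Set.Ioc 0 (2 * π)) := by
  rw [IntegrableOn, volume_restrict_Dom] at hF
  exact hF.integral_prod_right

lemma grad3_slice {u : Pt → ℝ} (hu : Differentiable ℝ u) (x : Pt3) (y : ℝ) (i : Fin 3) :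
    grad3 (fun x => u (x, y)) x i = gradx u (x, y) i := by
  have h : HasFDerivAt (fun x : Pt3 => u (x, y)) _ x :=
    (hu (x, y)).hasFDerivAt.comp x (hasFDerivAt_prodMk_left x y)
  unfold grad3 gradx
  rw [h.fderiv]
  rfl

lemma gradSq3_slice {u : Pt → ℝ} (hu : Differentiable ℝ u) (x : Pt3) (y : ℝ) :
    gradSq3 (fun x => u (x, y)) x = gradSqX u (x, y) :=
  Finset.sum_congr rfl fun i _ => by rw [grad3_slice hu]

lemma H1.ae_H1R3_slice {u : Pt → ℝ} (hu : H1 u) :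
    ∀ᵐ y ∂volume.restrict (Set.Ioc 0 (2 * π)), H1R3 fun x => u (x, y) := by
  filter_upwards [ae_integrable_slice hu.memL2, ae_integrable_slice hu.integrableOn_gradSqX,
    ae_integrable_slice hu.memL4] with y h2 hg h4
  refine ⟨hu.diff.comp (by fun_prop), h2, ?_, h4⟩
  simpa only [gradSq3_slice hu.diff] using hg

lemma lintegral_Dom {F : Pt → ENNReal} (hF : Measurable F) :
    ∫⁻ p in Dom, F p = ∫⁻ x, ∫⁻ y in Set.Ioc 0 (2 * π), F (x, y) := by
  rw [volume_restrict_Dom, lintegral_prod _ hF.aemeasurable]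

/-- The mass of a slice varies slowly if the `y`-derivative is small. -/
lemma abs_slice_mass_sub_le {u : Pt → ℝ} (hu : inS 1 u) {b : ℝ} (hb : 0 ≤ b)
    (hB : ∫ p in Dom, grady u p ^ 2 ≤ b ^ 2) {y : ℝ} (hy : y ∈ Set.Ioc 0 (2 * π))
    (hint : Integrable fun x => u (x, y) ^ 2) :
    |2 * π * (∫ x, u (x, y) ^ 2) - 1| ≤ 4 * π * b := by
  obtain ⟨hu, hl⟩ := hu
  have hmass : ∫ p in Dom, u p ^ 2 = 1 := by
    rwa [l2, Real.sqrt_eq_one] at hl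
  have hum : Measurable u := hu.diff.continuous.measurable
  have hgm := measurable_grady u
  have hpt : ∀ x, ∀ y ∈ Set.Ioc 0 (2 * π), ∀ y' ∈ Set.Ioc 0 (2 * π),
      ‖u (x, y) ^ 2 - u (x, y') ^ 2‖ₑ ≤
        ∫⁻ t in Set.Ioc 0 (2 * π), 2 * (‖u (x, t)‖ₑ * ‖grady u (x, t)‖ₑ) := by
    intro x y hy y' hy'
    have hd : ∀ t, HasDerivAt (fun t => u (x, t) ^ 2) (2 * (u (x, t) * grady u (x, t))) t :=
      fun t => by
        have h : HasDerivAt (fun t => u (x, t) ^ 2) _ t := (hasDerivAt_line_y hu.diff x t).pow 2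
        convert! h using 1
        norm_num; ring
    refine (enorm_sub_le_lintegral_deriv (g := fun t => u (x, t) ^ 2)
      (fun t => (hd t).differentiableAt) y' y).trans ?_
    have h2 : ∀ t, ‖deriv (fun t => u (x, t) ^ 2) t‖ₑ =
        2 * (‖u (x, t)‖ₑ * ‖grady u (x, t)‖ₑ) := fun t => by
      rw [(hd t).deriv, enorm_mul, enorm_mul]
      congr 1
      rw [← ofReal_norm]; norm_num
    simp_rw [h2]
    refine lintegral_mono_set fun t ht => ?_
    rw [Set.mem_uIoc] at ht
    rcases ht with ht | ht
    · exact ⟨hy'.1.trans ht.1, ht.2.trans hy.2⟩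
    · exact ⟨hy.1.trans ht.1, ht.2.trans hy'.2⟩
  have htot : ∫⁻ x, ∫⁻ t in Set.Ioc 0 (2 * π), 2 * (‖u (x, t)‖ₑ * ‖grady u (x, t)‖ₑ) ≤
      ENNReal.ofReal (2 * b) := by
    rw [← lintegral_Dom (F := fun p => 2 * (‖u p‖ₑ * ‖grady u p‖ₑ)) (by fun_prop),
      lintegral_const_mul _ (by fun_prop), ENNReal.ofReal_mul (by norm_num), ENNReal.ofReal_ofNat]
    refine mul_le_mul_right ?_ _
    have hcs := lintegral_mul_sq_le (μ := volume.restrict Dom) (f := fun p => ‖u p‖ₑ)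
      (g := fun p => ‖grady u p‖ₑ) hum.enorm.aemeasurable hgm.enorm.aemeasurable
    have hsq : ∀ {F : Pt → ℝ}, IntegrableOn (fun p => F p ^ 2) Dom →
        ∫⁻ p in Dom, ‖F p‖ₑ ^ 2 = ENNReal.ofReal (∫ p in Dom, F p ^ 2) := fun {F} hF => by
      rw [ofReal_integral_eq_lintegral_ofReal hF (ae_of_all _ fun p => by positivity)]
      refine lintegral_congr fun p => ?_
      rw [← enorm_pow, Real.enorm_of_nonneg (by positivity)]
    rw [hsq hu.memL2, hsq hu.integrableOn_grady_sq, hmass, ENNReal.ofReal_one, one_mul] at hcs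
    have h := hcs.trans (ENNReal.ofReal_le_ofReal hB)
    rw [ENNReal.ofReal_pow hb] at h
    exact (ENNReal.pow_le_pow_left_iff two_ne_zero).1 h
  have hM : ∀ y' ∈ Set.Ioc 0 (2 * π), (Integrable fun x => u (x, y') ^ 2) →
      ‖(∫ x, u (x, y) ^ 2) - ∫ x, u (x, y') ^ 2‖ ≤ 2 * b := fun y' hy' hint' => by
    rw [← integral_sub hint hint', ← ENNReal.ofReal_le_ofReal_iff (by positivity), ofReal_norm]
    exact (enorm_integral_le_lintegral_enorm _).trans
      ((lintegral_mono fun x => hpt x y hy y' hy').trans htot)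
  have hMint := integrableOn_integral_slice hu.memL2
  have hvol : (volume : Measure ℝ).real (Set.Ioc 0 (2 * π)) = 2 * π := by
    simp [Real.pi_pos.le]
  have heq : 2 * π * (∫ x, u (x, y) ^ 2) - 1 =
      ∫ y' in Set.Ioc 0 (2 * π), ((∫ x, u (x, y) ^ 2) - ∫ x, u (x, y') ^ 2) := by
    rw [integral_sub (integrable_const _) hMint, ← setIntegral_Dom hu.memL2, hmass,
      setIntegral_const, hvol, smul_eq_mul]
  rw [heq, ← Real.norm_eq_abs]
  have hfin : volume (Set.Ioc 0 (2 * π)) < ⊤ := measure_Ioc_lt_top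
  refine (norm_setIntegral_le_of_norm_le_const_ae' (C := 2 * b) hfin ?_).trans_eq ?_
  · rw [← ae_restrict_iff' measurableSet_Ioc]
    filter_upwards [ae_integrable_slice hu.memL2, ae_restrict_mem measurableSet_Ioc] with y' h1 h2
    exact hM y' h2 h1
  · rw [hvol]; ring

/-- A good slice: regular, with almost correct masses and at most average kinetic energy. -/
lemma exists_good_slice {u v : Pt → ℝ} (hu : H1 u) (hv : H1 v) :
    ∃ y ∈ Set.Ioc 0 (2 * π), (H1R3 fun x => u (x, y)) ∧ (H1R3 fun x => v (x, y)) ∧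
      2 * π * (∫ x, (gradSqX u (x, y) + gradSqX v (x, y))) ≤
        ∫ p in Dom, (gradSqX u p + gradSqX v p) := by
  have hI : IntegrableOn (fun p => gradSqX u p + gradSqX v p) Dom :=
    hu.integrableOn_gradSqX.add hv.integrableOn_gradSqX
  have hae : ∀ᵐ y ∂volume.restrict (Set.Ioc 0 (2 * π)), y ∈ Set.Ioc 0 (2 * π) ∧
      (H1R3 fun x => u (x, y)) ∧ (H1R3 fun x => v (x, y)) := by
    filter_upwards [hu.ae_H1R3_slice, hv.ae_H1R3_slice, ae_restrict_mem measurableSet_Ioc]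
      with y h1 h2 h3
    exact ⟨h3, h1, h2⟩
  have hne : volume.restrict (Set.Ioc 0 (2 * π)) ≠ 0 := by
    rw [Ne, Measure.restrict_eq_zero]
    simp [Real.pi_pos]
  obtain ⟨y, hyN, hy⟩ := exists_notMem_null_le_average hne (integrableOn_integral_slice hI)
    (ae_iff.1 hae)
  simp only [Set.mem_ofPred_eq, not_not] at hyN
  refine ⟨y, hyN.1, hyN.2.1, hyN.2.2, ?_⟩
  rw [setAverage_eq, ← setIntegral_Dom hI, smul_eq_mul] at hy
  have hvol : (volume : Measure ℝ).real (Set.Ioc 0 (2 * π)) = 2 * π := by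
    simp [Real.pi_pos.le]
  rwa [hvol, le_inv_mul_iff₀ (by positivity)] at hy

lemma hasFDerivAt_lift {f : Pt3 → ℝ} (hf : Differentiable ℝ f) (p : Pt) :
    HasFDerivAt (fun p : Pt => f p.1) ((fderiv ℝ f p.1).comp (ContinuousLinearMap.fst ℝ Pt3 ℝ)) p :=
  (hf p.1).hasFDerivAt.comp p hasFDerivAt_fst

lemma gradx_lift {f : Pt3 → ℝ} (hf : Differentiable ℝ f) (p : Pt) (i : Fin 3) :
    gradx (fun p : Pt => f p.1) p i = grad3 f p.1 i := by
  unfold gradx grad3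
  rw [(hasFDerivAt_lift hf p).fderiv]
  rfl

lemma gradSqX_lift {f : Pt3 → ℝ} (hf : Differentiable ℝ f) (p : Pt) :
    gradSqX (fun p : Pt => f p.1) p = gradSq3 f p.1 :=
  Finset.sum_congr rfl fun i _ => by rw [gradx_lift hf]

lemma grady_lift {f : Pt3 → ℝ} (hf : Differentiable ℝ f) (p : Pt) :
    grady (fun p : Pt => f p.1) p = 0 := by
  unfold grady
  rw [(hasFDerivAt_lift hf p).fderiv]
  simp [ey]

lemma H1R3.lift {f : Pt3 → ℝ} (hf : H1R3 f) : H1 fun p : Pt => f p.1 where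
  periodic _ _ := rfl
  diff := hf.diff.comp differentiable_fst
  memL2 := integrableOn_Dom_fst hf.memL2
  memGrad := by
    simpa [gradSq, gradSqX_lift hf.diff, grady_lift hf.diff] using integrableOn_Dom_fst hf.memGrad
  memL4 := integrableOn_Dom_fst hf.memL4

lemma H1R3.inS_lift {f : Pt3 → ℝ} (hf : H1R3 f) (hl : l2R3 f = 1 / √(2 * π)) :
    inS 1 fun p : Pt => f p.1 := by
  refine ⟨hf.lift, ?_⟩
  unfold l2
  rw [setIntegral_Dom_fst (fun x => f x ^ 2), Real.sqrt_mul (by positivity)]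
  change √(2 * π) * l2R3 f = 1
  rw [hl]
  field_simp

lemma integral_kinetic_lift {f g : Pt3 → ℝ} (hf : H1R3 f) (hg : H1R3 g) :
    ∫ p in Dom, (gradSqX (fun p : Pt => f p.1) p + gradSqX (fun p : Pt => g p.1) p) =
      2 * π * ∫ x, (gradSq3 f x + gradSq3 g x) := by
  simp only [gradSqX_lift hf.diff, gradSqX_lift hg.diff]
  exact setIntegral_Dom_fst fun x => gradSq3 f x + gradSq3 g x

lemma integral_nonlin_lift (f g : Pt3 → ℝ) :
    ∫ p in Dom, nonlin (fun p : Pt => f p.1) (fun p : Pt => g p.1) p =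
      2 * π * ∫ x, nonlin3 f g x :=
  setIntegral_Dom_fst (nonlin3 f g)

lemma svirial_lift {f g : Pt3 → ℝ} (hf : H1R3 f) (hg : H1R3 g) :
    svirial (fun p : Pt => f p.1) (fun p : Pt => g p.1) = 2 * π * Qhat f g := by
  unfold svirial Qhat
  rw [integral_kinetic_lift hf hg, integral_nonlin_lift]
  ring

lemma Jfun_lift {f g : Pt3 → ℝ} (hf : H1R3 f) (hg : H1R3 g) (μ : ℝ) :
    Jfun μ (fun p : Pt => f p.1) (fun p : Pt => g p.1) = 2 * π * Ihat f g := by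
  unfold Jfun Ihat
  have := integral_kinetic_lift hf hg
  simp only [grady_lift hf.diff, grady_lift hg.diff, zero_pow two_ne_zero, mul_zero, add_zero]
  rw [this, integral_nonlin_lift]
  ring

lemma Jfun_eq {u v : Pt → ℝ} (hu : H1 u) (hv : H1 v) (h : svirial u v = 0) (μ : ℝ) :
    Jfun μ u v = (∫ p in Dom, (gradSqX u p + gradSqX v p)) / 6 +
      μ / 2 * ∫ p in Dom, (grady u p ^ 2 + grady v p ^ 2) := by
  unfold svirial at h
  have hX : IntegrableOn (fun p => gradSqX u p + gradSqX v p) Dom :=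
    hu.integrableOn_gradSqX.add hv.integrableOn_gradSqX
  have hY : IntegrableOn (fun p => grady u p ^ 2 + grady v p ^ 2) Dom :=
    hu.integrableOn_grady_sq.add hv.integrableOn_grady_sq
  have hsplit : ∫ p in Dom, (gradSqX u p + μ * (grady u p) ^ 2 + gradSqX v p +
      μ * (grady v p) ^ 2) = (∫ p in Dom, (gradSqX u p + gradSqX v p)) +
        μ * ∫ p in Dom, (grady u p ^ 2 + grady v p ^ 2) := by
    rw [← integral_const_mul, ← integral_add hX (hY.const_mul μ)]
    refine integral_congr_ae (ae_of_all _ fun p => ?_)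
    ring
  unfold Jfun
  rw [hsplit]
  linarith

lemma integral_kinetic_nonneg (u v : Pt → ℝ) :
    0 ≤ ∫ p in Dom, (gradSqX u p + gradSqX v p) :=
  integral_nonneg fun p => add_nonneg (gradSqX_nonneg u p) (gradSqX_nonneg v p)

lemma integral_grady_nonneg (u v : Pt → ℝ) :
    0 ≤ ∫ p in Dom, (grady u p ^ 2 + grady v p ^ 2) :=
  integral_nonneg fun p => by positivity

lemma Jfun_nonneg {u v : Pt → ℝ} (hu : H1 u) (hv : H1 v) (h : svirial u v = 0) {μ : ℝ}
    (hμ : 0 ≤ μ) : 0 ≤ Jfun μ u v := by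
  have h1 := integral_kinetic_nonneg u v
  have h2 := integral_grady_nonneg u v
  rw [Jfun_eq hu hv h]
  positivity

lemma m1_nonneg {μ : ℝ} (hμ : 0 ≤ μ) : 0 ≤ m1 μ := by
  refine Real.sInf_nonneg ?_
  rintro c ⟨u, v, hu, hv, hQ, rfl⟩
  exact Jfun_nonneg hu.1 hv.1 hQ hμ

lemma m1_le_of_H1R3 {f g : Pt3 → ℝ} (hf : H1R3 f) (hg : H1R3 g) (hfl : l2R3 f = 1 / √(2 * π))
    (hgl : l2R3 g = 1 / √(2 * π)) (hQ : Qhat f g = 0) {μ : ℝ} (hμ : 0 ≤ μ) :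
    m1 μ ≤ 2 * π * Ihat f g := by
  rw [← Jfun_lift hf hg μ]
  refine csInf_le ⟨0, ?_⟩ ⟨_, _, hf.inS_lift hfl, hg.inS_lift hgl, ?_, rfl⟩
  · rintro c ⟨u, v, hu, hv, hQ, rfl⟩
    exact Jfun_nonneg hu.1 hv.1 hQ hμ
  · rw [svirial_lift hf hg, hQ, mul_zero]

lemma m1_le {μ : ℝ} (hμ : 0 ≤ μ) : m1 μ ≤ 2 * π * mhat (1 / √(2 * π)) := by
  rw [← div_le_iff₀' (by positivity)]
  refine le_csInf (mhat_set_nonempty (by positivity)) ?_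
  rintro c ⟨f, g, hf, hg, hfl, hgl, hQ, rfl⟩
  rw [div_le_iff₀' (by positivity)]
  exact m1_le_of_H1R3 hf hg hfl hgl hQ hμ

lemma m1_set_nonempty (μ : ℝ) :
    {c | ∃ u v : Pt → ℝ, inS 1 u ∧ inS 1 v ∧ svirial u v = 0 ∧ Jfun μ u v = c}.Nonempty := by
  obtain ⟨c, f, g, hf, hg, hfl, hgl, hQ, -⟩ :=
    mhat_set_nonempty (ρ := 1 / √(2 * π)) (by positivity)
  exact ⟨_, _, _, hf.inS_lift hfl, hg.inS_lift hgl, by rw [svirial_lift hf hg, hQ, mul_zero], rfl⟩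

/-- The `L⁴` distance of `u` to one of its slices. -/
lemma integral_sub_slice_pow_four_le {u : Pt → ℝ} (hu : H1 u) {y : ℝ}
    (hy : y ∈ Set.Ioc 0 (2 * π)) (hf : H1R3 fun x => u (x, y)) {s : ℝ} (hs : 0 < s) :
    IntegrableOn (fun p => (u p - u (p.1, y)) ^ 4) Dom ∧
      ∫ p in Dom, (u p - u (p.1, y)) ^ 4 ≤
        81 / s * (2 * (∫ p in Dom, gradSqX u p) + 2 * (2 * π * ∫ x, gradSqX u (x, y)) +
          s ^ 2 * ∫ p in Dom, grady u p ^ 2) ^ 2 := by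
  have hdl : Differentiable ℝ fun p : Pt => u (p.1, y) := hf.lift.diff
  have hdW : Differentiable ℝ fun p : Pt => u p - u (p.1, y) := hu.diff.sub hdl
  have hfd : ∀ p, fderiv ℝ (fun p : Pt => u p - u (p.1, y)) p =
      fderiv ℝ u p - fderiv ℝ (fun p : Pt => u (p.1, y)) p := fun p =>
    fderiv_sub (hu.diff p) (hdl p)
  have hgy : ∀ p, grady (fun p : Pt => u p - u (p.1, y)) p = grady u p := fun p => by
    have h : grady (fun p : Pt => u (p.1, y)) p = 0 := grady_lift hf.diff p
    unfold grady at h ⊢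
    rw [hfd, _root_.sub_apply, h, sub_zero]
  have hgx : ∀ p, gradSqX (fun p : Pt => u p - u (p.1, y)) p ≤
      2 * gradSqX u p + 2 * gradSqX u (p.1, y) := fun p => by
    have h : ∀ i, gradx (fun p : Pt => u (p.1, y)) p i = gradx u (p.1, y) i := fun i =>
      (gradx_lift hf.diff p i).trans (grad3_slice hu.diff p.1 y i)
    unfold gradSqX
    rw [Finset.mul_sum, Finset.mul_sum, ← Finset.sum_add_distrib]
    refine Finset.sum_le_sum fun i _ => ?_
    have h' : gradx (fun p : Pt => u p - u (p.1, y)) p i = gradx u p i - gradx u (p.1, y) i := by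
      rw [← h]
      unfold gradx
      rw [hfd, _root_.sub_apply]
    rw [h']
    nlinarith [sq_nonneg (gradx u p i + gradx u (p.1, y) i)]
  have h4 : IntegrableOn (fun p => (u p - u (p.1, y)) ^ 4) Dom := by
    refine ((hu.memL4.add hf.lift.memL4).const_mul 8).mono'
      (hdW.continuous.pow 4).aestronglyMeasurable (ae_of_all _ fun p => ?_)
    rw [Real.norm_of_nonneg (by positivity)]
    simp only [Pi.add_apply]
    nlinarith [sq_nonneg (u p + u (p.1, y)), sq_nonneg (u p ^ 2 - u (p.1, y) ^ 2),
      sq_nonneg ((u p + u (p.1, y)) ^ 2), sq_nonneg (u p ^ 2 + u (p.1, y) ^ 2 - 0),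
      mul_nonneg (sq_nonneg (u p + u (p.1, y))) (sq_nonneg (u p - u (p.1, y)))]
  have hsl : Integrable fun x => gradSqX u (x, y) := by
    simpa only [gradSq3_slice hu.diff] using hf.memGrad
  have hX2 := (hu.integrableOn_gradSqX.const_mul 2).add ((integrableOn_Dom_fst hsl).const_mul 2)
  have hX : IntegrableOn (gradSqX fun p : Pt => u p - u (p.1, y)) Dom := by
    refine hX2.mono' (measurable_gradSqX _).aestronglyMeasurable (ae_of_all _ fun p => ?_)
    rw [Real.norm_of_nonneg (gradSqX_nonneg _ p)]
    exact hgx p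
  have hXle : ∫ p in Dom, gradSqX (fun p : Pt => u p - u (p.1, y)) p ≤
      2 * (∫ p in Dom, gradSqX u p) + 2 * (2 * π * ∫ x, gradSqX u (x, y)) := by
    rw [← setIntegral_Dom_fst fun x => gradSqX u (x, y), ← integral_const_mul,
      ← integral_const_mul, ← integral_add (hu.integrableOn_gradSqX.const_mul 2)
        ((integrableOn_Dom_fst hsl).const_mul 2)]
    exact integral_mono hX hX2 hgx
  have hX0 : 0 ≤ ∫ p in Dom, gradSqX (fun p : Pt => u p - u (p.1, y)) p :=
    integral_nonneg (gradSqX_nonneg _)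
  have hY0 : 0 ≤ ∫ p in Dom, grady u p ^ 2 := integral_nonneg fun p => by positivity
  have hmain := setIntegral_pow_four_le hdW hy (fun x => sub_self _) h4 hX
    (by simpa only [hgy] using hu.integrableOn_grady_sq) hs
  simp only [hgy] at hmain
  refine ⟨h4, hmain.trans ?_⟩
  gcongr

lemma add_sq_le_of_mem_Ioo {t : ℝ} (h0 : 0 < t) (h1 : t < 1) (a b : ℝ) :
    (a + b) ^ 2 ≤ a ^ 2 / (1 - t) + b ^ 2 / t := by
  have h : 0 < 1 - t := by linarith
  rw [div_add_div _ _ h.ne' h0.ne', le_div_iff₀ (by positivity)]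
  nlinarith [sq_nonneg (t * a - (1 - t) * b)]

lemma quartic_split_le {t : ℝ} (h0 : 0 < t) (h1 : t < 1) (a b c d : ℝ) :
    ((a + b) ^ 2 + (c + d) ^ 2) ^ 2 ≤
      1 / (1 - t) ^ 3 * (a ^ 2 + c ^ 2) ^ 2 + 2 / t ^ 3 * (b ^ 4 + d ^ 4) := by
  have h : 0 < 1 - t := by linarith
  have hsum : (a + b) ^ 2 + (c + d) ^ 2 ≤ (a ^ 2 + c ^ 2) / (1 - t) + (b ^ 2 + d ^ 2) / t := by
    have := add_sq_le_of_mem_Ioo h0 h1 a b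
    have := add_sq_le_of_mem_Ioo h0 h1 c d
    rw [add_div, add_div]
    linarith
  calc ((a + b) ^ 2 + (c + d) ^ 2) ^ 2
      ≤ ((a ^ 2 + c ^ 2) / (1 - t) + (b ^ 2 + d ^ 2) / t) ^ 2 := by gcongr
    _ ≤ ((a ^ 2 + c ^ 2) / (1 - t)) ^ 2 / (1 - t) + ((b ^ 2 + d ^ 2) / t) ^ 2 / t :=
        add_sq_le_of_mem_Ioo h0 h1 _ _
    _ = 1 / (1 - t) ^ 3 * (a ^ 2 + c ^ 2) ^ 2 + 1 / t ^ 3 * (b ^ 2 + d ^ 2) ^ 2 := by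
        field_simp
    _ ≤ 1 / (1 - t) ^ 3 * (a ^ 2 + c ^ 2) ^ 2 + 1 / t ^ 3 * (2 * (b ^ 4 + d ^ 4)) := by
        gcongr
        nlinarith [sq_nonneg (b ^ 2 - d ^ 2)]
    _ = _ := by ring

/-- Comparison of the quartic energy with that of a slice. -/
lemma integral_nonlin_le_slice {u v : Pt → ℝ} (hu : H1 u) (hv : H1 v) {y : ℝ}
    (hf : H1R3 fun x => u (x, y)) (hg : H1R3 fun x => v (x, y))
    (hu4 : IntegrableOn (fun p => (u p - u (p.1, y)) ^ 4) Dom)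
    (hv4 : IntegrableOn (fun p => (v p - v (p.1, y)) ^ 4) Dom) {t : ℝ} (h0 : 0 < t) (h1 : t < 1) :
    ∫ p in Dom, nonlin u v p ≤
      1 / (1 - t) ^ 3 * (2 * π * ∫ x, nonlin3 (fun x => u (x, y)) (fun x => v (x, y)) x) +
        2 / t ^ 3 * ((∫ p in Dom, (u p - u (p.1, y)) ^ 4) +
          ∫ p in Dom, (v p - v (p.1, y)) ^ 4) := by
  have hn := integrableOn_Dom_fst (hf.integrable_nonlin3 hg)
  have hw : IntegrableOn (fun p => (u p - u (p.1, y)) ^ 4 + (v p - v (p.1, y)) ^ 4) Dom :=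
    hu4.add hv4
  rw [← setIntegral_Dom_fst, ← integral_add hu4 hv4, ← integral_const_mul, ← integral_const_mul,
    ← integral_add (hn.const_mul _) (hw.const_mul _)]
  refine integral_mono (integrableOn_nonlin hu hv)
    ((hn.const_mul _).add (hw.const_mul _)) fun p => ?_
  have h := quartic_split_le h0 h1 (u (p.1, y)) (u p - u (p.1, y)) (v (p.1, y)) (v p - v (p.1, y))
  simp only [add_sub_cancel] at h
  simpa only [nonlin_eq, nonlin3_eq] using h

/-- The factor comparing the semivirial identity with the sharp constant on `ℝ³` when the
`y`-derivative has squared norm at most `r ^ 12`. -/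
def virialFactor (m r : ℝ) : ℝ :=
  1 / (1 - r) ^ 3 *
    √(8 / 27 * ((1 + 4 * π * r ^ 6) ^ 4 / (1 - 4 * π * r ^ 6) ^ 3) / (2 * π * m)) + 8100 * r ^ 3

lemma le_sqrt_kinetic_mul {u v : Pt → ℝ} (hu : inS 1 u) (hv : inS 1 v) (hQ : svirial u v = 0)
    {r : ℝ} (hr0 : 0 < r) (hr1 : r < 1) (hr : 4 * π * r ^ 6 < 1)
    (hB : ∫ p in Dom, (grady u p ^ 2 + grady v p ^ 2) ≤ r ^ 12)
    (hm : 0 < mhat (1 / √(2 * π))) :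
    4 / 3 ≤ √(∫ p in Dom, (gradSqX u p + gradSqX v p)) *
      virialFactor (mhat (1 / √(2 * π))) r := by
  obtain ⟨y, hy, hf, hg, hkin⟩ := exists_good_slice hu.1 hv.1
  have hXu0 : 0 ≤ ∫ p in Dom, gradSqX u p := integral_nonneg (gradSqX_nonneg u)
  have hXv0 : 0 ≤ ∫ p in Dom, gradSqX v p := integral_nonneg (gradSqX_nonneg v)
  have hYu0 : 0 ≤ ∫ p in Dom, grady u p ^ 2 := integral_nonneg fun p => by positivity
  have hYv0 : 0 ≤ ∫ p in Dom, grady v p ^ 2 := integral_nonneg fun p => by positivity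
  have hSu0 : 0 ≤ ∫ x, gradSqX u (x, y) := integral_nonneg fun x => gradSqX_nonneg u _
  have hSv0 : 0 ≤ ∫ x, gradSqX v (x, y) := integral_nonneg fun x => gradSqX_nonneg v _
  have hAeq := integral_add hu.1.integrableOn_gradSqX hv.1.integrableOn_gradSqX
  rw [integral_add hu.1.integrableOn_grady_sq hv.1.integrableOn_grady_sq] at hB
  have hsu : Integrable fun x => gradSqX u (x, y) := by
    simpa only [gradSq3_slice hu.1.diff] using hf.memGrad
  have hsv : Integrable fun x => gradSqX v (x, y) := by
    simpa only [gradSq3_slice hv.1.diff] using hg.memGrad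
  have hkin_eq := integral_add hsu hsv
  have hb : (0 : ℝ) ≤ r ^ 6 := by positivity
  have hMu := abs_slice_mass_sub_le hu hb (by nlinarith) hy hf.memL2
  have hMv := abs_slice_mass_sub_le hv hb (by nlinarith) hy hg.memL2
  have hsharp := mhat_mul_sq_le hf hg hr hMu hMv
  have hspos := hf.integral_gradSq3_pos (by
    rw [abs_le] at hMu
    by_contra hcon
    have := mul_nonpos_of_nonneg_of_nonpos (by positivity : 0 ≤ 2 * π) (not_lt.1 hcon)
    linarith)
  have hn0 : 0 ≤ ∫ x, nonlin3 (fun x => u (x, y)) (fun x => v (x, y)) x :=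
    integral_nonneg fun x => by rw [nonlin3_eq]; positivity
  simp only [gradSq3_slice hu.1.diff, gradSq3_slice hv.1.diff] at hsharp hspos
  unfold svirial at hQ
  set A := ∫ p in Dom, (gradSqX u p + gradSqX v p) with hA
  set a := ∫ x, (gradSqX u (x, y) + gradSqX v (x, y)) with ha
  set n := ∫ x, nonlin3 (fun x => u (x, y)) (fun x => v (x, y)) x with hn
  set m := mhat (1 / √(2 * π))
  set κ := (1 + 4 * π * r ^ 6) ^ 4 / (1 - 4 * π * r ^ 6) ^ 3 with hκ
  have hκ0 : 0 < κ := by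
    have : 0 < 1 - 4 * π * r ^ 6 := by linarith
    positivity
  have ha0 : 0 < a := by linarith
  have hA0 : 0 < A := lt_of_lt_of_le (by positivity) hkin
  set q := √A with hq
  have hq0 : 0 < q := Real.sqrt_pos.2 hA0
  have hq2 : q ^ 2 = A := Real.sq_sqrt hA0.le
  have h2πu : 0 ≤ 2 * π * ∫ x, gradSqX u (x, y) := by positivity
  have h2πv : 0 ≤ 2 * π * ∫ x, gradSqX v (x, y) := by positivity
  rw [hkin_eq, mul_add] at hkin
  have hs : 0 < q / r ^ 6 := by positivity
  have hs2 : ∀ Y, 0 ≤ Y → Y ≤ r ^ 12 → (q / r ^ 6) ^ 2 * Y ≤ A := fun Y _ hY => by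
    calc (q / r ^ 6) ^ 2 * Y ≤ (q / r ^ 6) ^ 2 * r ^ 12 := by gcongr
      _ = A := by rw [← hq2]; field_simp
  have hconst : 81 / (q / r ^ 6) * (5 * A) ^ 2 = 2025 * r ^ 6 * (A * q) := by
    rw [← hq2]; field_simp; norm_num
  obtain ⟨hu4, hWu⟩ := integral_sub_slice_pow_four_le hu.1 hy hf hs
  obtain ⟨hv4, hWv⟩ := integral_sub_slice_pow_four_le hv.1 hy hg hs
  have hYu := hs2 _ hYu0 (by linarith)
  have hYv := hs2 _ hYv0 (by linarith)
  replace hWu : ∫ p in Dom, (u p - u (p.1, y)) ^ 4 ≤ 2025 * r ^ 6 * (A * q) := by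
    refine hWu.trans ?_
    rw [← hconst]
    gcongr
    linarith
  replace hWv : ∫ p in Dom, (v p - v (p.1, y)) ^ 4 ≤ 2025 * r ^ 6 * (A * q) := by
    refine hWv.trans ?_
    rw [← hconst]
    gcongr
    linarith
  have hN := integral_nonlin_le_slice hu.1 hv.1 hf hg hu4 hv4 hr0 hr1
  have hna : 2 * π * n ≤ √(8 / 27 * κ / (2 * π * m)) * (A * q) := by
    have haA : a ≤ A / (2 * π) := by
      rw [le_div_iff₀' (by positivity), hkin_eq, mul_add]; exact hkin
    refine (Real.le_sqrt_of_sq_le ?_).trans_eq (b := √(8 / 27 * κ / (2 * π * m) * (A * q) ^ 2)) ?_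
    · rw [div_mul_eq_mul_div, le_div_iff₀ (by positivity)]
      calc (2 * π * n) ^ 2 * (2 * π * m) = (2 * π) ^ 3 * (m * n ^ 2) := by ring
        _ ≤ (2 * π) ^ 3 * (8 / 27 * κ * a ^ 3) := by gcongr
        _ ≤ (2 * π) ^ 3 * (8 / 27 * κ * (A / (2 * π)) ^ 3) := by gcongr
        _ = 8 / 27 * κ * (A ^ 2 * A) := by field_simp
        _ = 8 / 27 * κ * (A * q) ^ 2 := by rw [mul_pow, hq2]
    · rw [Real.sqrt_mul (by positivity), Real.sqrt_sq (by positivity)]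
  have h1r : 0 < 1 - r := by linarith
  have hfin : 4 / 3 * A ≤ virialFactor m r * (A * q) := by
    calc 4 / 3 * A = ∫ p in Dom, nonlin u v p := by linarith
      _ ≤ 1 / (1 - r) ^ 3 * (√(8 / 27 * κ / (2 * π * m)) * (A * q)) +
          2 / r ^ 3 * (2025 * r ^ 6 * (A * q) + 2025 * r ^ 6 * (A * q)) :=
        hN.trans (by gcongr)
      _ = virialFactor m r * (A * q) := by
        unfold virialFactor
        rw [← hκ]
        field_simp
        ring
  refine le_of_mul_le_mul_right ?_ hA0
  linarith

lemma virialFactor_zero {m : ℝ} (hm : 0 < m) :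
    8 / 27 / virialFactor m 0 ^ 2 = 2 * π * m := by
  have h : virialFactor m 0 = √(8 / 27 / (2 * π * m)) := by simp [virialFactor]
  rw [h, Real.sq_sqrt (by positivity)]
  field_simp

lemma continuousAt_virialFactor (m : ℝ) : ContinuousAt (virialFactor m) 0 := by
  unfold virialFactor
  have h1 : ContinuousAt (fun r : ℝ => 1 / (1 - r) ^ 3) 0 :=
    continuousAt_const.div (by fun_prop) (by norm_num)
  have h2 : ContinuousAt
      (fun r : ℝ => (1 + 4 * π * r ^ 6) ^ 4 / (1 - 4 * π * r ^ 6) ^ 3) 0 :=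
    ContinuousAt.div (by fun_prop) (by fun_prop) (by norm_num)
  fun_prop

lemma kinetic_ge {u v : Pt → ℝ} (hu : inS 1 u) (hv : inS 1 v) (hQ : svirial u v = 0)
    {r : ℝ} (hr0 : 0 < r) (hr1 : r < 1) (hr : 4 * π * r ^ 6 < 1)
    (hB : ∫ p in Dom, (grady u p ^ 2 + grady v p ^ 2) ≤ r ^ 12)
    (hm : 0 < mhat (1 / √(2 * π))) :
    8 / 27 / virialFactor (mhat (1 / √(2 * π))) r ^ 2 ≤
      (∫ p in Dom, (gradSqX u p + gradSqX v p)) / 6 := by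
  have h := le_sqrt_kinetic_mul hu hv hQ hr0 hr1 hr hB hm
  have hA := integral_kinetic_nonneg u v
  set A := ∫ p in Dom, (gradSqX u p + gradSqX v p)
  set F := virialFactor (mhat (1 / √(2 * π))) r
  have hF : F ≠ 0 := by
    intro h0
    rw [h0] at h
    norm_num at h
  rw [div_le_iff₀ (by positivity)]
  have h2 := pow_le_pow_left₀ (by norm_num) h 2
  rw [mul_pow, Real.sq_sqrt hA] at h2
  linarith

lemma eventually_lt_m1 (hm : 0 < mhat (1 / √(2 * π))) {c : ℝ}
    (hc : c < 2 * π * mhat (1 / √(2 * π))) : ∀ᶠ μ in atTop, c < m1 μ := by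
  set m := mhat (1 / √(2 * π)) with hmdef
  obtain ⟨c', hcc', hc'⟩ := exists_between hc
  have hF0 : virialFactor m 0 ^ 2 ≠ 0 := by
    intro h
    have := virialFactor_zero hm
    rw [h, div_zero] at this
    have : 0 < 2 * π * m := by positivity
    linarith
  have hcont : ContinuousAt (fun r => 8 / 27 / virialFactor m r ^ 2) 0 :=
    continuousAt_const.div ((continuousAt_virialFactor m).pow 2) hF0
  have hev1 : ∀ᶠ r in nhdsWithin (0 : ℝ) (Set.Ioi 0), c' < 8 / 27 / virialFactor m r ^ 2 :=
    (hcont.eventually_const_lt (hc'.trans_eq (virialFactor_zero hm).symm)).filter_mono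
      nhdsWithin_le_nhds
  have hev2 : ∀ᶠ r in nhdsWithin (0 : ℝ) (Set.Ioi 0), 4 * π * r ^ 6 < 1 := by
    have : ContinuousAt (fun r : ℝ => 4 * π * r ^ 6) 0 := by fun_prop
    exact (this.eventually_lt_const (by norm_num)).filter_mono nhdsWithin_le_nhds
  have hev3 : ∀ᶠ r in nhdsWithin (0 : ℝ) (Set.Ioi 0), r < 1 :=
    (eventually_lt_nhds one_pos).filter_mono nhdsWithin_le_nhds
  obtain ⟨r, h1, h2, h3, hr0⟩ :=
    (hev1.and (hev2.and (hev3.and self_mem_nhdsWithin))).exists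
  replace hr0 : 0 < r := hr0
  filter_upwards [eventually_ge_atTop (4 * π * m / r ^ 12), eventually_gt_atTop 0] with μ hμ hμ0
  refine hcc'.trans_le (le_csInf (m1_set_nonempty μ) ?_)
  rintro _ ⟨u, v, hu, hv, hQ, rfl⟩
  have hA := integral_kinetic_nonneg u v
  have hB := integral_grady_nonneg u v
  rw [Jfun_eq hu.1 hv.1 hQ]
  by_cases hBr : ∫ p in Dom, (grady u p ^ 2 + grady v p ^ 2) ≤ r ^ 12
  · have := kinetic_ge hu hv hQ hr0 h3 h2 hBr hm
    have : 0 ≤ μ / 2 * ∫ p in Dom, (grady u p ^ 2 + grady v p ^ 2) := by positivity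
    linarith
  · rw [div_le_iff₀ (by positivity)] at hμ
    have := mul_le_mul_of_nonneg_left (not_le.1 hBr).le hμ0.le
    linarith

/-- `m_{1,μ} → 2π m̂_{1/√(2π)}` as `μ → ∞`, and `m_{1,μ} ≤ 2π m̂_{1/√(2π)}`
for every `μ > 0`. -/
theorem m1_tendsto_atTop :
    Filter.Tendsto m1 Filter.atTop (nhds (2 * π * mhat (1 / Real.sqrt (2 * π)))) ∧
    ∀ μ : ℝ, 0 < μ → m1 μ ≤ 2 * π * mhat (1 / Real.sqrt (2 * π)) := by
  have hm0 := mhat_nonneg (1 / √(2 * π))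
  refine ⟨tendsto_order.2 ⟨fun c hc => ?_, fun c hc => ?_⟩, fun μ hμ => m1_le hμ.le⟩
  · rcases hm0.eq_or_lt with hm | hm
    · rw [← hm, mul_zero] at hc
      filter_upwards [eventually_ge_atTop 0] with μ hμ
      exact hc.trans_le (m1_nonneg hμ)
    · exact eventually_lt_m1 hm hc
  · filter_upwards [eventually_ge_atTop 0] with μ hμ
    exact (m1_le hμ).trans_lt hc

end Waveguide
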